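/- Let f : ℕ → ℕ be any function and let a : ℕ → ℕ be the associated f-sequence. If S ⊆ ℕ is a nonempty finite f-legal set of indices (for any two distinct i, j ∈ S with j < i one has i − j > f(i)) whose largest element is m, then a(m) ≤ ∑_{i∈S} a(i) < a(m+1). In particular, two f-legal sums with different largest indices are distinct. -/

import Mathlib

/-- The `f`-sequence associated to `f : ℕ → ℕ`. -/
def fSeq (f : ℕ → ℕ) : ℕ → ℕ
  | 0 => 1
  | n + 1 => fSeq f n + (if f n ≤ n then fSeq f (n - f n) else 1)
  decreasing_by all_goals omega

/-- A finite set of indices `S` is `f`-legal. -/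
def FLegal (f : ℕ → ℕ) (S : Finset ℕ) : Prop :=
  ∀ i ∈ S, ∀ j ∈ S, j < i → f i < i - j

theorem fSeq_succ (f : ℕ → ℕ) (n : ℕ) :
    fSeq f (n + 1) = fSeq f n + (if f n ≤ n then fSeq f (n - f n) else 1) := by
  rw [fSeq]

theorem fSeq_monotone (f : ℕ → ℕ) : Monotone (fSeq f) :=
  monotone_nat_of_le_succ fun n => by
    rw [fSeq_succ]
    exact Nat.le_add_right _ _

theorem FLegal.mono {f : ℕ → ℕ} {S T : Finset ℕ} (hT : FLegal f T) (h : S ⊆ T) : FLegal f S :=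
  fun i hi j hj => hT i (h hi) j (h hj)

/-- An `f`-legal sum over indices below `n` is smaller than the `n`-th term. -/
theorem FLegal.sum_lt_fSeq {f : ℕ → ℕ} (n : ℕ) {S : Finset ℕ} (hS : FLegal f S)
    (hn : ∀ i ∈ S, i < n) : ∑ i ∈ S, fSeq f i < fSeq f n := by
  induction n using Nat.strong_induction_on generalizing S with
  | _ n ih =>
    cases n with
    | zero =>
      have hempty : S = ∅ := Finset.eq_empty_of_forall_notMem fun i hi => by
        simpa using hn i hi
      simp [hempty, fSeq]
    | succ n =>
      by_cases hmem : n ∈ S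
      · have hlegal : FLegal f (S.erase n) := hS.mono (S.erase_subset n)
        have hgap : ∀ i ∈ S.erase n, f n < n - i := fun i hi => by
          obtain ⟨hne, hi⟩ := Finset.mem_erase.1 hi
          have hlt := hn i hi
          exact hS n hmem i hi (by omega)
        rw [← Finset.add_sum_erase S _ hmem, fSeq_succ]
        gcongr
        split_ifs with h
        · refine ih _ (by omega) hlegal fun i hi => ?_
          have := hgap i hi
          omega
        · have hempty : S.erase n = ∅ := Finset.eq_empty_of_forall_notMem fun i hi => by
            have := hgap i hi
            omega
          simp [hempty]
      · refine (ih n n.lt_succ_self hS fun i hi => ?_).trans_le (fSeq_monotone f n.le_succ)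
        exact lt_of_le_of_ne (Nat.lt_succ_iff.1 (hn i hi)) fun h => hmem (h ▸ hi)

theorem fSeq_max'_le_sum (f : ℕ → ℕ) {S : Finset ℕ} (hS : S.Nonempty) :
    fSeq f (S.max' hS) ≤ ∑ i ∈ S, fSeq f i :=
  Finset.single_le_sum_of_canonicallyOrdered (f := fSeq f) (S.max'_mem hS)

theorem FLegal.sum_lt_sum {f : ℕ → ℕ} {S T : Finset ℕ} (hleg : FLegal f S) (hS : S.Nonempty)
    (hT : T.Nonempty) (h : S.max' hS < T.max' hT) :
    ∑ i ∈ S, fSeq f i < ∑ i ∈ T, fSeq f i :=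
  (hleg.sum_lt_fSeq _ fun i hi => (S.le_max' i hi).trans_lt h).trans_le (fSeq_max'_le_sum f hT)

theorem stmt19 (f : ℕ → ℕ) (S : Finset ℕ) (hS : S.Nonempty) (hleg : FLegal f S)
    (m : ℕ) (hm : m = S.max' hS) :
    (fSeq f m ≤ ∑ i ∈ S, fSeq f i ∧ ∑ i ∈ S, fSeq f i < fSeq f (m + 1)) ∧
    -- in particular, two `f`-legal sums with different largest indices are distinct
    ∀ (T : Finset ℕ) (hT : T.Nonempty), FLegal f T → S.max' hS ≠ T.max' hT →
      ∑ i ∈ S, fSeq f i ≠ ∑ i ∈ T, fSeq f i := by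
  subst hm
  refine ⟨⟨fSeq_max'_le_sum f hS, hleg.sum_lt_fSeq _ fun i hi =>
    Nat.lt_succ_iff.2 (S.le_max' i hi)⟩, fun T hT hlegT hne => ?_⟩
  rcases lt_or_gt_of_ne hne with h | h
  · exact (hleg.sum_lt_sum hS hT h).ne
  · exact (hlegT.sum_lt_sum hT hS h).ne'
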